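/- Let c be an idempotent of J and let x = x₁ + x_{1/2} + x₀ be the Peirce decomposition of an element x ∈ J relative to c (x₁ ∈ J(c,1), x_{1/2} ∈ J(c,1/2), x₀ ∈ J(c,0)). If x ∈ Ω, then x₁ ∈ Ω₁ and x₀ ∈ Ω₀, where Ω₁ and Ω₀ are the symmetric cones of the Jordan subalgebras J(c,1) and J(c,0) respectively. -/

import Mathlib

open scoped BigOperators Classical

/-- Bare data of a (real) Jordan algebra: a bilinear product and a unit element. -/
structure JordanData (J : Type) [AddCommGroup J] [Module ℝ J] where
  mul : J →ₗ[ℝ] J →ₗ[ℝ] J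
  e : J

namespace JordanData

variable {J : Type} [AddCommGroup J] [Module ℝ J] (A : JordanData J)

/-- `c` is an idempotent. -/
def IsIdem (c : J) : Prop := A.mul c c = c

/-- `c` is a primitive idempotent: a nonzero idempotent which dominates only `0` and itself. -/
def IsPrimitive (c : J) : Prop :=
  A.IsIdem c ∧ c ≠ 0 ∧ ∀ d : J, A.IsIdem d → A.mul c d = d → d = 0 ∨ d = c

/-- A Jordan frame: a complete system of pairwise orthogonal primitive idempotents. -/
def IsFrame {m : ℕ} (c : Fin m → J) : Prop :=
  (∀ j, A.IsPrimitive (c j)) ∧ (∀ i j, i ≠ j → A.mul (c i) (c j) = 0) ∧ ∑ j, c j = A.e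

end JordanData

/-- A simple Euclidean Jordan algebra of rank `rank`, together with its trace `tr`
and determinant `jdet` (characterized by their values on spectral decompositions). -/
structure EJA (J : Type) [NormedAddCommGroup J] [NormedSpace ℝ J] [FiniteDimensional ℝ J]
    extends JordanData J where
  comm : ∀ x y : J, mul x y = mul y x
  unit_mul : ∀ x : J, mul e x = x
  jordan : ∀ x y : J, mul (mul x x) (mul x y) = mul x (mul (mul x x) y)
  tr : J →ₗ[ℝ] ℝ
  tr_posdef : ∀ x : J, x ≠ 0 → 0 < tr (mul x x)
  simple : ∀ I : Submodule ℝ J, (∀ x ∈ I, ∀ y : J, mul y x ∈ I) → I = ⊥ ∨ I = ⊤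
  rank : ℕ
  spectral : ∀ x : J, ∃ (c : Fin rank → J) (lam : Fin rank → ℝ),
    toJordanData.IsFrame c ∧ x = ∑ j, lam j • c j
  tr_prim : ∀ c : J, toJordanData.IsPrimitive c → tr c = 1
  jdet : J → ℝ
  jdet_frame : ∀ (c : Fin rank → J) (lam : Fin rank → ℝ),
    toJordanData.IsFrame c → jdet (∑ j, lam j • c j) = ∏ j, lam j

namespace EJA

variable {J : Type} [NormedAddCommGroup J] [NormedSpace ℝ J] [FiniteDimensional ℝ J]

def IsIdem (A : EJA J) (c : J) : Prop := A.toJordanData.IsIdem c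

def IsPrimitive (A : EJA J) (c : J) : Prop := A.toJordanData.IsPrimitive c

def IsFrame (A : EJA J) {m : ℕ} (c : Fin m → J) : Prop := A.toJordanData.IsFrame c

/-- `x` has rank `k`: in a spectral decomposition of `x`, exactly `k` eigenvalues are nonzero. -/
def HasRank (A : EJA J) (x : J) (k : ℕ) : Prop :=
  ∃ (c : Fin A.rank → J) (lam : Fin A.rank → ℝ), A.IsFrame c ∧
    x = ∑ j, lam j • c j ∧ (Finset.univ.filter fun j => lam j ≠ 0).card = k

/-- The symmetric cone `Ω`: the interior of the set of squares. -/
def cone (A : EJA J) : Set J := interior {x : J | ∃ y : J, x = A.mul y y}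

/-- The Peirce space `J(c,t)`, i.e. the `t`-eigenspace of the multiplication operator `L(c)`. -/
def peirce (A : EJA J) (c : J) (t : ℝ) : Submodule ℝ J :=
  LinearMap.ker (A.mul c - t • (LinearMap.id : J →ₗ[ℝ] J))

/-- The symmetric cone of the Jordan subalgebra `J(c,t)` (`t = 1` or `t = 0`):
the relative interior, within `J(c,t)`, of the set of squares of elements of `J(c,t)`. -/
def subCone (A : EJA J) (c : J) (t : ℝ) : Set J :=
  {x : J | x ∈ A.peirce c t ∧ ∃ U : Set J, IsOpen U ∧ x ∈ U ∧
    ∀ y ∈ U, y ∈ A.peirce c t → ∃ w ∈ A.peirce c t, y = A.mul w w}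

/-- Powers in the Jordan algebra, with `x ^ 0 = e`. -/
def pow (A : EJA J) (x : J) : ℕ → J
  | 0 => A.e
  | n + 1 => A.mul x (A.pow x n)

/-- `y` is the Jordan inverse of `x`: `y` lies in the subalgebra `ℝ[x]` and `x·y = e`. -/
def IsInverse (A : EJA J) (x y : J) : Prop :=
  y ∈ Submodule.span ℝ (Set.range (A.pow x)) ∧ A.mul x y = A.e

/-- The set of invertible linear maps preserving the symmetric cone. -/
def conePreserving (A : EJA J) : Set (J →L[ℝ] J)ˣ :=
  {g | (g : J →L[ℝ] J) '' A.cone = A.cone}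

theorem one_mem_conePreserving (A : EJA J) : 1 ∈ A.conePreserving := by
  show (↑(1 : (J →L[ℝ] J)ˣ) : J →L[ℝ] J) '' A.cone = A.cone
  simp

/-- The group `L`: the identity component of the group of linear transformations of `J`
preserving the symmetric cone `Ω`. -/
def Lgroup (A : EJA J) : Set (J →L[ℝ] J)ˣ :=
  {g | ∃ h : g ∈ A.conePreserving,
    (⟨g, h⟩ : A.conePreserving) ∈ connectedComponent ⟨1, A.one_mem_conePreserving⟩}

end EJA

namespace EJA
variable {J : Type} [NormedAddCommGroup J] [NormedSpace ℝ J] [FiniteDimensional ℝ J]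

theorem aux_lin (A : EJA J) (x y z w : J) :
    A.mul x (A.mul (A.mul y z) w) + A.mul y (A.mul (A.mul z x) w)
      + A.mul z (A.mul (A.mul x y) w)
    = A.mul (A.mul y z) (A.mul x w) + A.mul (A.mul z x) (A.mul y w)
      + A.mul (A.mul x y) (A.mul z w) := by
  have hx := A.jordan x w
  have hy := A.jordan y w
  have hz := A.jordan z w
  have hxy := A.jordan (x + y) w
  have hyz := A.jordan (y + z) w
  have hzx := A.jordan (z + x) w
  have hxyz := A.jordan (x + y + z) w
  simp only [map_add, LinearMap.add_apply, A.comm y x, A.comm z y, A.comm x z] at *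
  linear_combination (norm := module) (-1/2 : ℝ) • (hxyz - hxy - hyz - hzx + hx + hy + hz)

theorem aux_op (A : EJA J) (x y z : J) :
    A.mul x * A.mul (A.mul y z) + A.mul y * A.mul (A.mul z x) + A.mul z * A.mul (A.mul x y)
    = A.mul (A.mul (A.mul y z) x) + A.mul y * A.mul x * A.mul z
      + A.mul z * A.mul x * A.mul y := by
  ext w
  have h1 := A.aux_lin x y z w
  have h2 := A.aux_lin w y z x
  simp only [LinearMap.add_apply, Module.End.mul_apply]
  rw [A.comm (A.mul z w) x, A.comm (A.mul w y) x, A.comm w y, A.comm w x,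
    A.comm (A.mul z w) (A.mul y x), A.comm (A.mul y w) (A.mul z x), A.comm y x,
    A.comm w (A.mul (A.mul y z) x)] at h2
  linear_combination (norm := module) h1 - h2

/-- trace form functional -/
noncomputable def tau (A : EJA J) : J →ₗ[ℝ] ℝ := LinearMap.trace ℝ J ∘ₗ A.mul

theorem tau_assoc (A : EJA J) (x y z : J) :
    A.tau (A.mul (A.mul y z) x) = A.tau (A.mul (A.mul x z) y) := by
  have h1 := congrArg (LinearMap.trace ℝ J) (A.aux_op x y z)
  have h2 := congrArg (LinearMap.trace ℝ J) (A.aux_op y x z)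
  simp only [map_add] at h1 h2
  rw [A.comm z x, A.comm x y] at h1
  rw [A.comm z y] at h2
  rw [LinearMap.trace_mul_cycle ℝ (A.mul y)] at h1
  rw [LinearMap.trace_mul_cycle ℝ (A.mul x), LinearMap.trace_mul_cycle ℝ (A.mul z) (A.mul x)] at h2
  simp only [tau, LinearMap.comp_apply]
  rw [← LinearMap.trace_mul_cycle ℝ (A.mul z) (A.mul x)] at h2
  have e1 := LinearMap.trace_mul_cycle ℝ (A.mul x) (A.mul y) (A.mul z)
  have e2 := LinearMap.trace_mul_cycle ℝ (A.mul y) (A.mul x) (A.mul z)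
  have e3 := LinearMap.trace_mul_cycle ℝ (A.mul z) (A.mul x) (A.mul y)
  have e4 := LinearMap.trace_mul_cycle ℝ (A.mul z) (A.mul y) (A.mul x)
  linarith

/-- L(a) is symmetric for the form. -/
theorem tau_symm (A : EJA J) (a x y : J) :
    A.tau (A.mul (A.mul a x) y) = A.tau (A.mul x (A.mul a y)) := by
  rw [A.tau_assoc y a x, A.comm x (A.mul a y), A.tau_assoc x a y, A.comm x y]

theorem cube (A : EJA J) {c : J} (hc : A.mul c c = c) (v : J) :
    A.mul c (A.mul c (A.mul c v)) = (3/2 : ℝ) • A.mul c (A.mul c v) - (1/2 : ℝ) • A.mul c v := by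
  have h := congrArg (fun f => f v) (A.aux_op c c c)
  simp only [LinearMap.add_apply, Module.End.mul_apply, hc] at h
  linear_combination (norm := module) (-1/2 : ℝ) • h

/-- Projection on J(c,1). -/
noncomputable def P1 (A : EJA J) (c : J) : J →ₗ[ℝ] J :=
  (2 : ℝ) • (A.mul c * A.mul c) - A.mul c

noncomputable def Ph (A : EJA J) (c : J) : J →ₗ[ℝ] J :=
  (4 : ℝ) • (A.mul c - A.mul c * A.mul c)

theorem P1_apply (A : EJA J) (c v : J) :
    A.P1 c v = (2 : ℝ) • A.mul c (A.mul c v) - A.mul c v := by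
  simp [P1]

theorem Ph_apply (A : EJA J) (c v : J) :
    A.Ph c v = (4 : ℝ) • (A.mul c v - A.mul c (A.mul c v)) := by
  simp [Ph]

theorem P1_idem (A : EJA J) {c : J} (hc : A.mul c c = c) (v : J) :
    A.P1 c (A.P1 c v) = A.P1 c v := by
  simp only [P1_apply, map_sub, map_smul, A.cube hc]
  module

theorem Ph_idem (A : EJA J) {c : J} (hc : A.mul c c = c) (v : J) :
    A.Ph c (A.Ph c v) = A.Ph c v := by
  simp only [Ph_apply, map_sub, map_smul, A.cube hc]
  module

theorem mul_P1 (A : EJA J) {c : J} (hc : A.mul c c = c) (v : J) :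
    A.mul c (A.P1 c v) = A.P1 c v := by
  simp only [P1_apply, map_sub, map_smul, A.cube hc]
  module

theorem mul_eq_P (A : EJA J) (c : J) :
    A.mul c = A.P1 c + (1/2 : ℝ) • A.Ph c := by
  ext v
  simp only [P1_apply, Ph_apply, LinearMap.add_apply, LinearMap.smul_apply]
  module

theorem P1_symm (A : EJA J) (c x y : J) :
    A.tau (A.mul (A.P1 c x) y) = A.tau (A.mul x (A.P1 c y)) := by
  simp only [P1_apply, map_sub, map_smul, LinearMap.sub_apply, LinearMap.smul_apply, tau_symm]

theorem Ph_symm (A : EJA J) (c x y : J) :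
    A.tau (A.mul (A.Ph c x) y) = A.tau (A.mul x (A.Ph c y)) := by
  simp only [Ph_apply, map_sub, map_smul, LinearMap.sub_apply, LinearMap.smul_apply, tau_symm]

theorem trace_idem (f : J →ₗ[ℝ] J) (hf : ∀ v, f (f v) = f v) :
    LinearMap.trace ℝ J f = Module.finrank ℝ (LinearMap.range f) := by
  apply LinearMap.IsProj.trace (p := LinearMap.range f)
  constructor
  · intro x; exact ⟨x, rfl⟩
  · rintro _ ⟨x, rfl⟩; exact hf x

theorem tau_pos (A : EJA J) {c : J} (hc : A.mul c c = c) (h0 : c ≠ 0) : 0 < A.tau c := by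
  have : A.tau c = LinearMap.trace ℝ J (A.P1 c) + (1/2) * LinearMap.trace ℝ J (A.Ph c) := by
    rw [tau, LinearMap.comp_apply, mul_eq_P, map_add, map_smul, smul_eq_mul]
  rw [this, trace_idem _ (A.P1_idem hc), trace_idem _ (A.Ph_idem hc)]
  have : 0 < Module.finrank ℝ (LinearMap.range (A.P1 c)) := by
    rw [Module.finrank_pos_iff_exists_ne_zero]
    refine ⟨⟨c, c, ?_⟩, ?_⟩
    · rw [P1_apply, hc, hc]; module
    · simpa [Subtype.ext_iff] using h0
  positivity

theorem frame_mul (A : EJA J) {m : ℕ} {c : Fin m → J} (hc : A.toJordanData.IsFrame c)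
    (a b : Fin m → ℝ) :
    A.mul (∑ j, a j • c j) (∑ j, b j • c j) = ∑ j, (a j * b j) • c j := by
  simp only [map_sum, LinearMap.sum_apply, map_smul, LinearMap.smul_apply]
  apply Finset.sum_congr rfl
  intro j _
  rw [Finset.sum_eq_single j]
  · rw [show A.mul (c j) (c j) = c j from (hc.1 j).1, smul_smul, mul_comm]
  · intro i _ hij
    rw [hc.2.1 i j hij]; simp
  · simp

theorem tau_sq_nonneg (A : EJA J) (x : J) : 0 ≤ A.tau (A.mul x x) := by
  obtain ⟨c, l, hc, rfl⟩ := A.spectral x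
  rw [A.frame_mul hc, map_sum]
  apply Finset.sum_nonneg
  intro j _
  rw [map_smul, smul_eq_mul]
  exact mul_nonneg (mul_self_nonneg _) (A.tau_pos (hc.1 j).1 (hc.1 j).2.1).le

theorem tau_idem_nonneg (A : EJA J) {c : J} (hc : A.mul c c = c) (y : J) :
    0 ≤ A.tau (A.mul (A.mul y y) c) := by
  rw [A.tau_assoc, A.mul_eq_P c]
  simp only [LinearMap.add_apply, LinearMap.smul_apply, map_add, map_smul, smul_eq_mul]
  rw [← A.P1_idem hc, ← A.Ph_idem hc, A.P1_symm, A.Ph_symm]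
  have h1 := A.tau_sq_nonneg (A.P1 c y)
  have h2 := A.tau_sq_nonneg (A.Ph c y)
  linarith

theorem mem_p1 (A : EJA J) (c v : J) (t : ℝ) : v ∈ A.peirce c t ↔ A.mul c v = t • v := by
  simp [peirce, sub_eq_zero]

theorem p1_mul (A : EJA J) {c : J} (hc : A.mul c c = c) {a b : J}
    (ha : a ∈ A.peirce c 1) (hb : b ∈ A.peirce c 1) : A.mul a b ∈ A.peirce c 1 := by
  rw [mem_p1, one_smul] at *
  have h := A.aux_lin c c a b
  rw [ha, A.comm a c, ha, hc, hb] at h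
  linear_combination (norm := module) h

theorem p1_fun (A : EJA J) {c : J} (hc : A.mul c c = c) {m : ℕ} {d : Fin m → J}
    (hd : A.toJordanData.IsFrame d) (l : Fin m → ℝ) (hz : ∑ j, l j • d j ∈ A.peirce c 1)
    (f : ℝ → ℝ) (hf : f 0 = 0) : ∑ j, f (l j) • d j ∈ A.peirce c 1 := by
  have hpow : ∀ n : ℕ, ∑ j, (l j ^ (n+1)) • d j ∈ A.peirce c 1 := by
    intro n
    induction n with
    | zero => simpa using hz
    | succ n ih =>
      have := A.p1_mul hc ih hz
      rw [A.frame_mul hd] at this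
      simpa [pow_succ] using this
  have hpoly : ∀ p : Polynomial ℝ, ∑ j, (l j * p.eval (l j)) • d j ∈ A.peirce c 1 := by
    intro p
    induction p using Polynomial.induction_on' with
    | add p q hp hq =>
      have := Submodule.add_mem _ hp hq
      rw [← Finset.sum_add_distrib] at this
      simpa [mul_add, add_smul] using this
    | monomial n a =>
      have := Submodule.smul_mem _ a (hpow n)
      rw [Finset.smul_sum] at this
      convert this using 2 with j
      rw [smul_smul, Polynomial.eval_monomial]
      congr 1; ring
  have := hpoly (Lagrange.interpolate (Finset.univ.image l) id (fun t => f t / t))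
  convert this using 2 with j
  have h := Lagrange.eval_interpolate_at_node (s := Finset.univ.image l) (v := id)
    (fun t => f t / t) (Function.injective_id.injOn) (Finset.mem_image_of_mem l (Finset.mem_univ j))
  rw [id] at h
  rw [h]
  by_cases h0 : l j = 0
  · simp [h0, hf]
  · congr 1; field_simp

theorem P1_of_mem (A : EJA J) {c v : J} {t : ℝ} (h : v ∈ A.peirce c t) :
    A.P1 c v = (2 * t^2 - t) • v := by
  rw [mem_p1] at h
  rw [P1_apply, h, map_smul, h]; module

theorem sq_P1 (A : EJA J) {c : J} (hc : A.mul c c = c) (y : J) :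
    ∃ w ∈ A.peirce c 1, A.P1 c (A.mul y y) = A.mul w w := by
  have hz : A.P1 c (A.mul y y) ∈ A.peirce c 1 := by
    rw [mem_p1, one_smul, A.mul_P1 hc]
  obtain ⟨d, l, hd, hzd⟩ := A.spectral (A.P1 c (A.mul y y))
  have hz' := hz
  rw [hzd] at hz'
  have hm := A.p1_fun hc hd l hz' (fun t => max (-t) 0) (by simp)
  have hw := A.p1_fun hc hd l hz' Real.sqrt (by simp)
  have key : 0 ≤ A.tau (A.mul (A.P1 c (A.mul y y)) (∑ j, max (-l j) 0 • d j)) := by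
    rw [A.P1_symm, A.P1_of_mem hm]
    norm_num
    apply Finset.sum_nonneg
    intro j _
    exact mul_nonneg (le_max_right _ _) (A.tau_idem_nonneg (hd.1 j).1 y)
  have hl : ∀ j, 0 ≤ l j := by
    rw [hzd, A.frame_mul hd, map_sum] at key
    simp only [map_smul, smul_eq_mul] at key
    have hneg : ∀ j ∈ Finset.univ, l j * max (-l j) 0 * A.tau (d j) ≤ 0 := by
      intro j _
      have := A.tau_pos (hd.1 j).1 (hd.1 j).2.1
      apply mul_nonpos_of_nonpos_of_nonneg _ this.le
      rcases le_total (l j) 0 with h | h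
      · exact mul_nonpos_of_nonpos_of_nonneg h (le_max_right _ _)
      · rw [max_eq_right (by linarith)]; simp
    have h0 := (Finset.sum_eq_zero_iff_of_nonpos hneg).1 (le_antisymm (Finset.sum_nonpos hneg) key)
    intro j
    by_contra hj
    push Not at hj
    have := h0 j (Finset.mem_univ j)
    rw [max_eq_left (by linarith)] at this
    have hp := A.tau_pos (hd.1 j).1 (hd.1 j).2.1
    have : 0 < l j * l j * A.tau (d j) := mul_pos (mul_pos_of_neg_of_neg hj hj) hp
    linarith
  refine ⟨_, hw, ?_⟩
  rw [A.frame_mul hd, hzd]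
  refine Finset.sum_congr rfl fun j _ => ?_
  rw [Real.mul_self_sqrt (hl j)]

theorem main1 (A : EJA J) {c : J} (hc : A.mul c c = c)
    (x1 xh x0 : J) (h1 : x1 ∈ A.peirce c 1) (hh : xh ∈ A.peirce c (1/2))
    (h0 : x0 ∈ A.peirce c 0) (hΩ : x1 + xh + x0 ∈ A.cone) : x1 ∈ A.subCone c 1 := by
  refine ⟨h1, (fun y => y + xh + x0) ⁻¹' A.cone, ?_, hΩ, ?_⟩
  · exact isOpen_interior.preimage (by fun_prop)
  · intro y hy hy1
    obtain ⟨s, hs⟩ := interior_subset hy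
    obtain ⟨w, hw, e⟩ := A.sq_P1 hc s
    refine ⟨w, hw, ?_⟩
    rw [← e, ← hs]
    simp only [map_add]
    rw [A.P1_of_mem hy1, A.P1_of_mem hh, A.P1_of_mem h0]
    module

theorem peirce_compl (A : EJA J) (c : J) (t : ℝ) : A.peirce (A.e - c) t = A.peirce c (1 - t) := by
  ext v
  rw [mem_p1, mem_p1, map_sub, LinearMap.sub_apply, A.unit_mul]
  constructor
  · intro h; linear_combination (norm := module) -h
  · intro h; linear_combination (norm := module) -h

end EJA

/-- Let `c` be an idempotent of `J` and `x = x₁ + x_{1/2} + x₀` the Peirce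
decomposition of `x` relative to `c`.  If `x ∈ Ω` then `x₁ ∈ Ω₁` and `x₀ ∈ Ω₀`, where
`Ω₁`, `Ω₀` are the symmetric cones of the Jordan subalgebras `J(c,1)` and `J(c,0)`. -/
theorem EJA.peirce_components_mem_subCone {J : Type} [NormedAddCommGroup J]
    [NormedSpace ℝ J] [FiniteDimensional ℝ J] (A : EJA J) (c : J) (hc : A.IsIdem c)
    (x x1 xh x0 : J) (h1 : x1 ∈ A.peirce c 1) (hh : xh ∈ A.peirce c (1/2))
    (h0 : x0 ∈ A.peirce c 0) (hx : x = x1 + xh + x0) (hΩ : x ∈ A.cone) :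
    x1 ∈ A.subCone c 1 ∧ x0 ∈ A.subCone c 0 := by
  subst hx
  have hc' : A.mul c c = c := hc
  refine ⟨A.main1 hc' x1 xh x0 h1 hh h0 hΩ, ?_⟩
  have hce : A.mul (A.e - c) (A.e - c) = A.e - c := by
    simp only [map_sub, LinearMap.sub_apply, A.unit_mul]
    rw [A.comm c A.e, A.unit_mul, hc']; abel
  have := A.main1 hce x0 xh x1 (by rw [A.peirce_compl]; simpa using h0)
    (by rw [A.peirce_compl]; norm_num at hh ⊢; exact hh) (by rw [A.peirce_compl]; simpa using h1)
    (by rwa [show x0 + xh + x1 = x1 + xh + x0 by abel])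
  unfold EJA.subCone at this ⊢
  simpa [A.peirce_compl] using this
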